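/- Let n ≥ 1 and 0 < q, θ < ∞. Let u, w be weights on (0,∞) and v a weight on ℝⁿ. Define ṽ(t) := ess sup_{s' ∈ S^{n-1}} v(t s') for t > 0. Then the following are equivalent: (i) there exists a constant C such that (∫₀^∞ (∫_{B(0,t)} f(s) v(s) ds)^q u(t) dt)^{1/q} ≤ C (∫₀^∞ (∫_{B(0,t)} f(s) ds)^θ w(t) dt)^{1/θ} for every nonnegative measurable f on ℝⁿ; (ii) there exists a constant C' such that (∫₀^∞ (∫₀^t g(s) ṽ(s) ds)^q u(t) dt)^{1/q} ≤ C' (∫₀^∞ (∫₀^t g(s) ds)^θ w(t) dt)^{1/θ} for every nonnegative measurable g on (0,∞). Moreover, the best constants satisfy C ≈ C', i.e. they are comparable with comparison constants independent of u, v, w. -/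

import Mathlib

open MeasureTheory Set ENNReal

noncomputable section

/-- The set `B(a,b) = {y ∈ ℝⁿ : a < |y| < b}`. -/
def annulus (n : ℕ) (a b : ℝ) : Set (EuclideanSpace ℝ (Fin n)) :=
  {y | a < ‖y‖ ∧ ‖y‖ < b}

theorem annulus_meas (n : ℕ) (t : ℝ) : MeasurableSet (annulus n 0 t) := by
  unfold annulus
  exact (measurableSet_lt measurable_const measurable_norm).inter
    (measurableSet_lt measurable_norm measurable_const)

theorem norm_smul_sph {n : ℕ} {τ : ℝ} (hτ : 0 < τ)
    (s : Metric.sphere (0 : EuclideanSpace ℝ (Fin n)) 1) :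
    ‖τ • (s : EuclideanSpace ℝ (Fin n))‖ = τ := by
  rw [norm_smul, norm_eq_of_mem_sphere, mul_one, Real.norm_of_nonneg hτ.le]

theorem polar_ann (n : ℕ)
    (σ : Measure (Metric.sphere (0 : EuclideanSpace ℝ (Fin n)) 1))
    (hσ : ∀ f : EuclideanSpace ℝ (Fin n) → ℝ≥0∞, Measurable f →
      (∫⁻ x, f x) = ∫⁻ τ in Ioi (0 : ℝ),
        ∫⁻ s', f (τ • (s' : EuclideanSpace ℝ (Fin n))) * ENNReal.ofReal (τ ^ (n - 1)) ∂σ)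
    (f : EuclideanSpace ℝ (Fin n) → ℝ≥0∞) (hf : Measurable f) (t : ℝ) :
    (∫⁻ x in annulus n 0 t, f x) = ∫⁻ τ in Ioo (0 : ℝ) t,
        ∫⁻ s', f (τ • (s' : EuclideanSpace ℝ (Fin n))) * ENNReal.ofReal (τ ^ (n - 1)) ∂σ := by
  rw [← lintegral_indicator (annulus_meas n t), hσ _ (hf.indicator (annulus_meas n t)),
    ← lintegral_indicator measurableSet_Ioi, ← lintegral_indicator measurableSet_Ioo]
  congr 1
  funext τ
  by_cases h0 : 0 < τ
  · rw [indicator_of_mem (show τ ∈ Ioi 0 from h0)]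
    by_cases ht : τ < t
    · rw [indicator_of_mem (show τ ∈ Ioo 0 t from ⟨h0, ht⟩)]
      congr 1
      funext s
      rw [indicator_of_mem]
      exact ⟨by rw [norm_smul_sph h0]; exact h0, by rw [norm_smul_sph h0]; exact ht⟩
    · rw [indicator_of_notMem (fun h : τ ∈ Ioo 0 t => ht h.2)]
      rw [← lintegral_zero (μ := σ)]
      congr 1
      funext s
      rw [indicator_of_notMem, zero_mul]
      intro h
      have := h.2
      rw [norm_smul_sph h0] at this
      exact ht this
  · rw [indicator_of_notMem (fun h : τ ∈ Ioi 0 => h0 h),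
      indicator_of_notMem (fun h : τ ∈ Ioo 0 t => h0 h.1)]

theorem sigma_fin (n : ℕ)
    (σ : Measure (Metric.sphere (0 : EuclideanSpace ℝ (Fin n)) 1))
    (hσ : ∀ f : EuclideanSpace ℝ (Fin n) → ℝ≥0∞, Measurable f →
      (∫⁻ x, f x) = ∫⁻ τ in Ioi (0 : ℝ),
        ∫⁻ s', f (τ • (s' : EuclideanSpace ℝ (Fin n))) * ENNReal.ofReal (τ ^ (n - 1)) ∂σ) :
    IsFiniteMeasure σ := by
  constructor
  by_contra h
  have htop : σ univ = ⊤ := by simpa using h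
  have h1 := polar_ann n σ hσ (fun _ => 1) measurable_const 1
  have h2 : (∫⁻ x in annulus n 0 1, (1 : ℝ≥0∞)) < ⊤ := by
    rw [setLIntegral_one]
    refine lt_of_le_of_lt (measure_mono ?_) (measure_ball_lt_top (x := 0) (r := 1))
    intro x hx
    simpa using hx.2
  have h3 : (∫⁻ τ in Ioo (0 : ℝ) 1,
        ∫⁻ s', (1 : ℝ≥0∞) * ENNReal.ofReal (τ ^ (n - 1)) ∂σ) = ⊤ := by
    have : (∫⁻ τ in Ioo (0 : ℝ) 1,
        ∫⁻ s', (1 : ℝ≥0∞) * ENNReal.ofReal (τ ^ (n - 1)) ∂σ) = ∫⁻ τ in Ioo (0 : ℝ) 1, ⊤ := by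
      refine setLIntegral_congr_fun measurableSet_Ioo ?_
      intro τ hτ
      have : ENNReal.ofReal (τ ^ (n - 1)) ≠ 0 := by
        simpa using pow_pos hτ.1 _
      simp [htop, this]
    rw [this]; simp
  rw [h1, h3] at h2
  exact lt_irrefl _ h2

theorem meas_joint {n : ℕ} {f : EuclideanSpace ℝ (Fin n) → ℝ≥0∞} (hf : Measurable f) :
    Measurable (fun p : ℝ × Metric.sphere (0 : EuclideanSpace ℝ (Fin n)) 1 =>
      f (p.1 • (p.2 : EuclideanSpace ℝ (Fin n)))) := by
  apply hf.comp
  exact measurable_fst.smul (measurable_subtype_coe.comp measurable_snd)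

theorem lt_essSup_iff' {α : Type*} [MeasurableSpace α] (μ : Measure α) (f : α → ℝ≥0∞)
    (a : ℝ≥0∞) : a < essSup f μ ↔ 0 < μ {x | a < f x} := by
  rw [← not_iff_not, not_lt, not_lt, nonpos_iff_eq_zero]
  constructor
  · intro h
    have : ∀ᵐ x ∂μ, f x ≤ a := (ENNReal.ae_le_essSup f).mono fun x hx => hx.trans h
    simpa [ae_iff] using this
  · intro h
    have : ∀ᵐ x ∂μ, f x ≤ a := by simpa [ae_iff] using h
    exact essSup_le_of_ae_le a this

theorem meas_tv {n : ℕ} (σ : Measure (Metric.sphere (0 : EuclideanSpace ℝ (Fin n)) 1))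
    [IsFiniteMeasure σ] {v : EuclideanSpace ℝ (Fin n) → ℝ≥0∞} (hv : Measurable v) :
    Measurable (fun t : ℝ => essSup (fun s' : Metric.sphere (0 : EuclideanSpace ℝ (Fin n)) 1 =>
            v (t • (s' : EuclideanSpace ℝ (Fin n)))) σ) := by
  apply measurable_of_Ioi
  intro a
  have : MeasurableSet {p : ℝ × Metric.sphere (0 : EuclideanSpace ℝ (Fin n)) 1 |
      a < v (p.1 • (p.2 : EuclideanSpace ℝ (Fin n)))} :=
    measurableSet_lt measurable_const (meas_joint hv)
  have h2 := measurable_measure_prodMk_left (ν := σ) this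
  have h3 := measurableSet_lt (measurable_const (a := (0 : ℝ≥0∞))) h2
  convert h3 using 1
  ext t
  simp only [mem_preimage, mem_Ioi, mem_setOf_eq]
  exact lt_essSup_iff' _ _ _

/-- truncation -/
def lam (k : ℕ) (x : ℝ≥0∞) : ℝ≥0∞ := min (k : ℝ≥0∞) (x * (1 - (k + 1 : ℝ≥0∞)⁻¹))

theorem lam_meas (k : ℕ) : Measurable (lam k) := by
  unfold lam
  exact measurable_const.min (measurable_id.mul_const _)

theorem lam_mono (x : ℝ≥0∞) : Monotone (fun k => lam k x) := by
  intro a b h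
  unfold lam
  have h' : (a : ℝ≥0∞) ≤ b := by exact_mod_cast h
  dsimp only
  gcongr

theorem lam_lt (k : ℕ) {x : ℝ≥0∞} (hx : x ≠ 0) : lam k x < x := by
  unfold lam
  by_cases h : x = ⊤
  · subst h
    exact lt_of_le_of_lt (min_le_left _ _) (by simp)
  · refine lt_of_le_of_lt (min_le_right _ _) ?_
    have h1 : (1 - (k + 1 : ℝ≥0∞)⁻¹) < 1 := by
      apply ENNReal.sub_lt_self <;> simp
    calc x * (1 - (k + 1 : ℝ≥0∞)⁻¹) < x * 1 := (ENNReal.mul_lt_mul_iff_right hx h).2 h1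
      _ = x := mul_one x

theorem lam_tendsto (x : ℝ≥0∞) : Filter.Tendsto (fun k => lam k x) Filter.atTop (nhds x) := by
  have h1 : Filter.Tendsto (fun k : ℕ => (k : ℝ≥0∞)) Filter.atTop (nhds ⊤) :=
    ENNReal.tendsto_nat_nhds_top
  have h2 : Filter.Tendsto (fun k : ℕ => (k + 1 : ℝ≥0∞)⁻¹) Filter.atTop (nhds 0) := by
    have := (Filter.tendsto_add_atTop_iff_nat 1).2 ENNReal.tendsto_inv_nat_nhds_zero
    simpa using this
  have h3 : Filter.Tendsto (fun k : ℕ => (1 - (k + 1 : ℝ≥0∞)⁻¹)) Filter.atTop (nhds 1) := by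
    have := ENNReal.Tendsto.sub (tendsto_const_nhds (x := (1 : ℝ≥0∞))) h2 (by simp)
    simpa using this
  have h4 := ENNReal.Tendsto.const_mul (a := x) h3 (by simp)
  have := h1.min h4
  simpa [lam] using this

theorem one_to_n (n : ℕ)
    (σ : Measure (Metric.sphere (0 : EuclideanSpace ℝ (Fin n)) 1)) [IsFiniteMeasure σ]
    (hσ : ∀ f : EuclideanSpace ℝ (Fin n) → ℝ≥0∞, Measurable f →
      (∫⁻ x, f x) = ∫⁻ τ in Ioi (0 : ℝ),
        ∫⁻ s', f (τ • (s' : EuclideanSpace ℝ (Fin n))) * ENNReal.ofReal (τ ^ (n - 1)) ∂σ)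
    (v : EuclideanSpace ℝ (Fin n) → ℝ≥0∞) (hv : Measurable v)
    (f : EuclideanSpace ℝ (Fin n) → ℝ≥0∞) (hf : Measurable f) :
    ∃ g : ℝ → ℝ≥0∞, Measurable g ∧
      (∀ t, ∫⁻ s in annulus n 0 t, f s = ∫⁻ s in Ioo (0 : ℝ) t, g s) ∧
      (∀ t, ∫⁻ s in annulus n 0 t, f s * v s ≤ ∫⁻ s in Ioo (0 : ℝ) t, g s *
        essSup (fun s' : Metric.sphere (0 : EuclideanSpace ℝ (Fin n)) 1 =>
            v (s • (s' : EuclideanSpace ℝ (Fin n)))) σ) := by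
  have hm := meas_joint hf
  refine ⟨fun τ => ∫⁻ s', f (τ • (s' : EuclideanSpace ℝ (Fin n))) *
    ENNReal.ofReal (τ ^ (n - 1)) ∂σ, ?_, fun t => polar_ann n σ hσ f hf t, fun t => ?_⟩
  · apply Measurable.lintegral_prod_right'
      (f := fun p : ℝ × Metric.sphere (0 : EuclideanSpace ℝ (Fin n)) 1 =>
        f (p.1 • (p.2 : EuclideanSpace ℝ (Fin n))) * ENNReal.ofReal (p.1 ^ (n - 1)))
    exact hm.mul (by fun_prop)
  · rw [polar_ann n σ hσ (fun s => f s * v s) (hf.mul hv) t]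
    apply lintegral_mono
    intro τ
    dsimp only
    rw [← lintegral_mul_const]
    · apply lintegral_mono_ae
      filter_upwards [ENNReal.ae_le_essSup (μ := σ)
        (fun s' : Metric.sphere (0 : EuclideanSpace ℝ (Fin n)) 1 =>
            v (τ • (s' : EuclideanSpace ℝ (Fin n))))] with s hs
      rw [mul_right_comm]
      gcongr
    · exact (hm.comp measurable_prodMk_left).mul_const _

theorem n_to_one (n : ℕ)
    (σ : Measure (Metric.sphere (0 : EuclideanSpace ℝ (Fin n)) 1)) [IsFiniteMeasure σ]
    (hσ : ∀ f : EuclideanSpace ℝ (Fin n) → ℝ≥0∞, Measurable f →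
      (∫⁻ x, f x) = ∫⁻ τ in Ioi (0 : ℝ),
        ∫⁻ s', f (τ • (s' : EuclideanSpace ℝ (Fin n))) * ENNReal.ofReal (τ ^ (n - 1)) ∂σ)
    (v : EuclideanSpace ℝ (Fin n) → ℝ≥0∞) (hv : Measurable v)
    (g l : ℝ → ℝ≥0∞) (hg : Measurable g) (hl : Measurable l)
    (hlt : ∀ t, l t = 0 ∨ l t < essSup (fun s' : Metric.sphere (0 : EuclideanSpace ℝ (Fin n)) 1 =>
            v (t • (s' : EuclideanSpace ℝ (Fin n)))) σ) :
    ∃ f : EuclideanSpace ℝ (Fin n) → ℝ≥0∞, Measurable f ∧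
      (∀ t, ∫⁻ s in annulus n 0 t, f s ≤ ∫⁻ s in Ioo (0 : ℝ) t, g s) ∧
      (∀ t, ∫⁻ s in Ioo (0 : ℝ) t, g s * l s ≤ ∫⁻ s in annulus n 0 t, f s * v s) := by
  have hset : MeasurableSet {p : ℝ × Metric.sphere (0 : EuclideanSpace ℝ (Fin n)) 1 |
      l p.1 < v (p.1 • (p.2 : EuclideanSpace ℝ (Fin n)))} :=
    measurableSet_lt (hl.comp measurable_fst) (meas_joint hv)
  set A : ℝ → Set (Metric.sphere (0 : EuclideanSpace ℝ (Fin n)) 1) :=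
    fun t => {s | l t < v (t • (s : EuclideanSpace ℝ (Fin n)))} with hA
  have hAm : ∀ t, MeasurableSet (A t) := fun t => measurable_prodMk_left hset
  have hS : Measurable (fun t => σ (A t)) := measurable_measure_prodMk_left (ν := σ) hset
  have hE : MeasurableSet {x : EuclideanSpace ℝ (Fin n) | l ‖x‖ < v x} :=
    measurableSet_lt (hl.comp measurable_norm) hv
  set c : ℝ → ℝ≥0∞ := fun τ => g τ * (σ (A τ))⁻¹ * (ENNReal.ofReal (τ ^ (n - 1)))⁻¹ with hc
  have hcm : Measurable c := (hg.mul hS.inv).mul (by fun_prop)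
  set f : EuclideanSpace ℝ (Fin n) → ℝ≥0∞ :=
    {x | l ‖x‖ < v x}.indicator (fun x => c ‖x‖) with hf
  have hfm : Measurable f := (hcm.comp measurable_norm).indicator hE
  have hfv : ∀ τ, 0 < τ → ∀ s : Metric.sphere (0 : EuclideanSpace ℝ (Fin n)) 1,
      f (τ • (s : EuclideanSpace ℝ (Fin n))) = (A τ).indicator (fun _ => c τ) s := by
    intro τ hτ s
    simp only [hf, hA, indicator, mem_setOf_eq, norm_smul_sph hτ]
  have hpow : ∀ τ : ℝ, 0 < τ → (ENNReal.ofReal (τ ^ (n - 1)))⁻¹ * ENNReal.ofReal (τ ^ (n - 1)) = 1 := by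
    intro τ hτ
    apply ENNReal.inv_mul_cancel
    · simpa using pow_pos hτ _
    · simp
  refine ⟨f, hfm, fun t => ?_, fun t => ?_⟩
  · rw [polar_ann n σ hσ f hfm t]
    refine setLIntegral_mono hg fun τ hτ => ?_
    simp only [hfv τ hτ.1]
    rw [lintegral_mul_const _ (measurable_const.indicator (hAm τ)),
      lintegral_indicator_const (hAm τ)]
    calc c τ * σ (A τ) * ENNReal.ofReal (τ ^ (n - 1))
        = g τ * ((σ (A τ))⁻¹ * σ (A τ)) *
          ((ENNReal.ofReal (τ ^ (n - 1)))⁻¹ * ENNReal.ofReal (τ ^ (n - 1))) := by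
          simp only [hc]; ring
      _ ≤ g τ * 1 * 1 := by
          rw [hpow τ hτ.1]
          gcongr
          exact ENNReal.inv_mul_le_one _
      _ = g τ := by simp
  · rw [polar_ann n σ hσ (fun s => f s * v s) (hfm.mul hv) t]
    refine setLIntegral_mono' measurableSet_Ioo fun τ hτ => ?_
    rcases hlt τ with h0 | h1
    · simp [h0]
    have hpos : 0 < σ (A τ) := (lt_essSup_iff' σ _ _).1 h1
    calc g τ * l τ = g τ * ((σ (A τ))⁻¹ * σ (A τ)) *
          ((ENNReal.ofReal (τ ^ (n - 1)))⁻¹ * ENNReal.ofReal (τ ^ (n - 1))) * l τ := by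
          rw [hpow τ hτ.1, ENNReal.inv_mul_cancel hpos.ne' (measure_ne_top _ _)]; simp
      _ = (c τ * l τ * ENNReal.ofReal (τ ^ (n - 1))) * σ (A τ) := by
          simp only [hc]; ring
      _ = ∫⁻ s, (A τ).indicator (fun _ => c τ * l τ * ENNReal.ofReal (τ ^ (n - 1))) s ∂σ := by
          rw [lintegral_indicator_const (hAm τ)]
      _ ≤ _ := by
          apply lintegral_mono
          intro s
          dsimp only
          rw [hfv τ hτ.1]
          by_cases hs : s ∈ A τ
          · rw [indicator_of_mem hs, indicator_of_mem hs]
            have : l τ ≤ v (τ • (s : EuclideanSpace ℝ (Fin n))) := le_of_lt hs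
            gcongr
          · rw [indicator_of_notMem hs]; exact zero_le

theorem main_iff (n : ℕ) (q θ : ℝ) (hq : 0 < q) (hθ : 0 < θ)
    (σ : Measure (Metric.sphere (0 : EuclideanSpace ℝ (Fin n)) 1))
    (hσ : ∀ f : EuclideanSpace ℝ (Fin n) → ℝ≥0∞, Measurable f →
      (∫⁻ x, f x) = ∫⁻ τ in Ioi (0 : ℝ),
        ∫⁻ s', f (τ • (s' : EuclideanSpace ℝ (Fin n))) * ENNReal.ofReal (τ ^ (n - 1)) ∂σ)
    (u w : ℝ → ℝ≥0∞) (v : EuclideanSpace ℝ (Fin n) → ℝ≥0∞)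
    (hu : Measurable u) (hv : Measurable v)
    (tv : ℝ → ℝ≥0∞) (htv : tv = fun t =>
          essSup (fun s' : Metric.sphere (0 : EuclideanSpace ℝ (Fin n)) 1 =>
            v (t • (s' : EuclideanSpace ℝ (Fin n)))) σ) (C : ℝ≥0∞) :
    (∀ f : EuclideanSpace ℝ (Fin n) → ℝ≥0∞, Measurable f →
      (∫⁻ t in Ioi (0 : ℝ), (∫⁻ s in annulus n 0 t, f s * v s) ^ q * u t) ^ (1 / q) ≤ C *
      (∫⁻ t in Ioi (0 : ℝ), (∫⁻ s in annulus n 0 t, f s) ^ θ * w t) ^ (1 / θ)) ↔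
    (∀ g : ℝ → ℝ≥0∞, Measurable g →
      (∫⁻ t in Ioi (0 : ℝ), (∫⁻ s in Ioo (0 : ℝ) t, g s * tv s) ^ q * u t) ^ (1 / q) ≤ C *
      (∫⁻ t in Ioi (0 : ℝ), (∫⁻ s in Ioo (0 : ℝ) t, g s) ^ θ * w t) ^ (1 / θ)) := by
  haveI := sigma_fin n σ hσ
  have hq' : 0 ≤ 1 / q := by positivity
  have hθ' : 0 ≤ 1 / θ := by positivity
  constructor
  · intro H g hg
    have htm : Measurable tv := htv ▸ meas_tv σ hv
    have key : ∀ k : ℕ,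
        (∫⁻ t in Ioi (0 : ℝ), (∫⁻ s in Ioo (0 : ℝ) t, g s * lam k (tv s)) ^ q * u t) ^ (1 / q)
        ≤ C * (∫⁻ t in Ioi (0 : ℝ), (∫⁻ s in Ioo (0 : ℝ) t, g s) ^ θ * w t) ^ (1 / θ) := by
      intro k
      obtain ⟨f, hf, h1, h2⟩ := n_to_one n σ hσ v hv g (fun s => lam k (tv s)) hg
        ((lam_meas k).comp htm) (by
          intro t
          by_cases h : tv t = 0
          · left; simp [h, lam]
          · right
            have := lam_lt k h
            simpa only [htv] using this)
      refine le_trans ?_ ((H f hf).trans ?_)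
      · gcongr with t
        exact h2 t
      · gcongr with t
        exact h1 t
    have inner : ∀ t : ℝ, Filter.Tendsto
        (fun k => ∫⁻ s in Ioo (0 : ℝ) t, g s * lam k (tv s)) Filter.atTop
        (nhds (∫⁻ s in Ioo (0 : ℝ) t, g s * tv s)) := by
      intro t
      apply lintegral_tendsto_of_tendsto_of_monotone
      · intro k
        exact (hg.mul ((lam_meas k).comp htm)).aemeasurable
      · refine Filter.Eventually.of_forall fun s a b hab => ?_
        exact mul_le_mul_right (lam_mono (tv s) hab) _
      · refine Filter.Eventually.of_forall fun s => ?_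
        by_cases h0 : tv s = 0
        · simp [h0, lam]
        · exact ENNReal.Tendsto.const_mul (lam_tendsto _) (Or.inl h0)
    have innermono : ∀ t : ℝ, Monotone (fun k => ∫⁻ s in Ioo (0 : ℝ) t, g s * lam k (tv s)) := by
      intro t a b hab
      exact lintegral_mono fun s => mul_le_mul_right (lam_mono (tv s) hab) _
    have outer : Filter.Tendsto (fun k =>
        ∫⁻ t in Ioi (0 : ℝ), (∫⁻ s in Ioo (0 : ℝ) t, g s * lam k (tv s)) ^ q * u t)
        Filter.atTop
        (nhds (∫⁻ t in Ioi (0 : ℝ), (∫⁻ s in Ioo (0 : ℝ) t, g s * tv s) ^ q * u t)) := by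
      apply lintegral_tendsto_of_tendsto_of_monotone
      · intro k
        refine Measurable.aemeasurable (Measurable.mul (Measurable.pow_const ?_ q) hu)
        apply Monotone.measurable
        intro a b hab
        exact lintegral_mono_set (Ioo_subset_Ioo_right hab)
      · refine Filter.Eventually.of_forall fun t a b hab => ?_
        dsimp only
        gcongr
        exact lam_mono _ hab
      · refine Filter.Eventually.of_forall fun t => ?_
        by_cases h0 : (∫⁻ s in Ioo (0 : ℝ) t, g s * tv s) = 0
        · have hk : ∀ k, (∫⁻ s in Ioo (0 : ℝ) t, g s * lam k (tv s)) = 0 := by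
            intro k
            have := (innermono t).ge_of_tendsto (inner t) k
            rw [h0] at this
            exact le_antisymm this zero_le
          simp [h0, hk]
        · refine ENNReal.Tendsto.mul_const ((inner t).ennrpow_const q) (Or.inl ?_)
          exact fun h => h0 (by simpa [ENNReal.rpow_eq_zero_iff, hq, hq.not_gt] using h)
    exact le_of_tendsto' (outer.ennrpow_const (1 / q)) key
  · intro H f hf
    obtain ⟨g, hg, h1, h2⟩ := one_to_n n σ hσ v hv f hf
    refine le_trans ?_ ((H g hg).trans ?_)
    · gcongr with t
      subst htv
      exact h2 t
    · simp only [h1]; exact le_rfl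

theorem statement3 (n : ℕ) (hn : 1 ≤ n) (q θ : ℝ) (hq : 0 < q) (hθ : 0 < θ)
    (σ : Measure (Metric.sphere (0 : EuclideanSpace ℝ (Fin n)) 1))
    (hσ : ∀ f : EuclideanSpace ℝ (Fin n) → ℝ≥0∞, Measurable f →
      (∫⁻ x, f x) = ∫⁻ τ in Ioi (0 : ℝ),
        ∫⁻ s', f (τ • (s' : EuclideanSpace ℝ (Fin n))) * ENNReal.ofReal (τ ^ (n - 1)) ∂σ) :
    -- the comparison constants are independent of the weights u, v, w
    ∃ c₁ c₂ : ℝ≥0∞, 0 < c₁ ∧ c₂ ≠ ⊤ ∧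
      ∀ (u w : ℝ → ℝ≥0∞) (v : EuclideanSpace ℝ (Fin n) → ℝ≥0∞),
        Measurable u → (∀ᵐ t ∂(volume.restrict (Ioi (0 : ℝ))), 0 < u t ∧ u t < ⊤) →
        Measurable w → (∀ᵐ t ∂(volume.restrict (Ioi (0 : ℝ))), 0 < w t ∧ w t < ⊤) →
        Measurable v →
        (∀ᵐ x ∂(volume : Measure (EuclideanSpace ℝ (Fin n))), 0 < v x ∧ v x < ⊤) →
        let tv : ℝ → ℝ≥0∞ := fun t =>
          essSup (fun s' : Metric.sphere (0 : EuclideanSpace ℝ (Fin n)) 1 =>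
            v (t • (s' : EuclideanSpace ℝ (Fin n)))) σ
        let LHSn : (EuclideanSpace ℝ (Fin n) → ℝ≥0∞) → ℝ≥0∞ := fun f =>
          (∫⁻ t in Ioi (0 : ℝ), (∫⁻ s in annulus n 0 t, f s * v s) ^ q * u t) ^ (1 / q)
        let RHSn : (EuclideanSpace ℝ (Fin n) → ℝ≥0∞) → ℝ≥0∞ := fun f =>
          (∫⁻ t in Ioi (0 : ℝ), (∫⁻ s in annulus n 0 t, f s) ^ θ * w t) ^ (1 / θ)
        let LHS1 : (ℝ → ℝ≥0∞) → ℝ≥0∞ := fun g =>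
          (∫⁻ t in Ioi (0 : ℝ), (∫⁻ s in Ioo (0 : ℝ) t, g s * tv s) ^ q * u t) ^ (1 / q)
        let RHS1 : (ℝ → ℝ≥0∞) → ℝ≥0∞ := fun g =>
          (∫⁻ t in Ioi (0 : ℝ), (∫⁻ s in Ioo (0 : ℝ) t, g s) ^ θ * w t) ^ (1 / θ)
        ((∃ C : ℝ≥0∞, C ≠ ⊤ ∧ ∀ f : EuclideanSpace ℝ (Fin n) → ℝ≥0∞, Measurable f →
            LHSn f ≤ C * RHSn f) ↔
          (∃ C' : ℝ≥0∞, C' ≠ ⊤ ∧ ∀ g : ℝ → ℝ≥0∞, Measurable g → LHS1 g ≤ C' * RHS1 g)) ∧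
        c₁ * sInf {C' : ℝ≥0∞ | ∀ g : ℝ → ℝ≥0∞, Measurable g → LHS1 g ≤ C' * RHS1 g} ≤
          sInf {C : ℝ≥0∞ | ∀ f : EuclideanSpace ℝ (Fin n) → ℝ≥0∞, Measurable f →
            LHSn f ≤ C * RHSn f} ∧
        sInf {C : ℝ≥0∞ | ∀ f : EuclideanSpace ℝ (Fin n) → ℝ≥0∞, Measurable f →
            LHSn f ≤ C * RHSn f} ≤
          c₂ * sInf {C' : ℝ≥0∞ | ∀ g : ℝ → ℝ≥0∞, Measurable g → LHS1 g ≤ C' * RHS1 g} := by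
  refine ⟨1, 1, one_pos, by simp, ?_⟩
  intro u w v hu _ hw _ hv _ tv LHSn RHSn LHS1 RHS1
  have key : ∀ C : ℝ≥0∞, (∀ f : EuclideanSpace ℝ (Fin n) → ℝ≥0∞, Measurable f →
            LHSn f ≤ C * RHSn f) ↔ (∀ g : ℝ → ℝ≥0∞, Measurable g → LHS1 g ≤ C * RHS1 g) :=
    fun C => main_iff n q θ hq hθ σ hσ u w v hu hv tv rfl C
  refine ⟨exists_congr fun C => and_congr_right fun _ => key C, ?_, ?_⟩
  · simp only [key, one_mul]; exact le_rfl
  · simp only [key, one_mul]; exact le_rfl
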